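/- There exists a constant c_0 > 0 such that for every n ≥ 1 and every q ∈ (0,1), if the equispaced placement x^eq is optimal (i.e., C(x^eq) ≤ C(x) for all x ∈ [0,1]^n) for every failure probability p ∈ (0, q), then q ≤ c_0/n. In other words, the neighborhood of p = 0 on which x^eq is optimal has length at most c_0/n. -/

import Mathlib

open Finset MeasureTheory

/-- Coverage cost on the line `[0,1]` for placement `x` and active set `A`:
the largest distance from a point of `[0,1]` to the closest active sensor
(`1` by convention if `A = ∅`). -/
noncomputable def cost0 {n : ℕ} (x : Fin n → ℝ) (A : Finset (Fin n)) : ℝ :=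
  if A.Nonempty then ⨆ s : Set.Icc (0:ℝ) 1, ⨅ j : A, |s.1 - x j.1| else 1

/-- Probability that `A` is the active set, under independent failures with
probability `p`. -/
noncomputable def prob {n : ℕ} (p : ℝ) (A : Finset (Fin n)) : ℝ :=
  p ^ (n - A.card) * (1 - p) ^ A.card

/-- Expected coverage cost `C(x)` under independent failures with probability `p`. -/
noncomputable def expCost {n : ℕ} (p : ℝ) (x : Fin n → ℝ) : ℝ :=
  ∑ A : Finset (Fin n), prob p A * cost0 x A

/-- The equispaced placement `x^eq`, whose `i`-th entry (`i = 0, …, n-1`) is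
`(2i+1)/(2n)`. -/
noncomputable def xeq (n : ℕ) : Fin n → ℝ := fun i => (2 * (i : ℝ) + 1) / (2 * n)

/-- The `k`-th smallest element of the finite set `A` (0-based). -/
noncomputable def nth {n : ℕ} (A : Finset (Fin n)) (k : Fin A.card) : Fin n :=
  (A.orderIsoOfFin rfl k).1

/-- Coverage cost on the circle of circumference 1 for the active set `A`. -/
noncomputable def ccost0 {n : ℕ} (x : Fin n → ℝ) (A : Finset (Fin n)) : ℝ :=
  if A.Nonempty then
    ⨆ s : Set.Icc (0:ℝ) 1, ⨅ j : A, min |s.1 - x j.1| (1 - |s.1 - x j.1|)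
  else 1

/-- Expected circle coverage cost `C̃(x)`. -/
noncomputable def cExpCost {n : ℕ} (p : ℝ) (x : Fin n → ℝ) : ℝ :=
  ∑ A : Finset (Fin n), prob p A * ccost0 x A

/-- Harmonic number `H_m = ∑_{h=1}^m 1/h`. -/
noncomputable def H (m : ℕ) : ℝ := ∑ i ∈ Finset.range m, 1 / ((i : ℝ) + 1)

/-- Length of the longest run of consecutive indices of `{0, …, n-1}` not
belonging to `A`. -/
noncomputable def longestRun {n : ℕ} (A : Finset (Fin n)) : ℕ :=
  sSup {r : ℕ | ∃ a : ℕ, a + r ≤ n ∧ ∀ i : Fin n, a ≤ i.1 → i.1 < a + r → i ∉ A}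

/-- Expected cost in the Cortés (constant-number-of-failures) model where
exactly `k` sensors fail, uniformly at random. -/
noncomputable def cortesCost {n : ℕ} (k : ℕ) (x : Fin n → ℝ) : ℝ :=
  (n.choose k : ℝ)⁻¹ *
    ∑ A ∈ Finset.univ.filter (fun A : Finset (Fin n) => A.card = n - k), cost0 x A

/-- Expectation over the random uniform i.i.d. placement `x^rand ∈ [0,1]^n`
of the expected cost `C(x^rand)`. -/
noncomputable def randExp (n : ℕ) (p : ℝ) : ℝ :=
  ∫ x in Set.univ.pi (fun _ : Fin n => Set.Icc (0:ℝ) 1), expCost p x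

/-- `E[C_0(x^{rand,m})]`: expected coverage cost of `m` i.i.d. uniform sensors,
all active. -/
noncomputable def randCost0 (m : ℕ) : ℝ :=
  ∫ x in Set.univ.pi (fun _ : Fin m => Set.Icc (0:ℝ) 1), cost0 x Finset.univ

/-- `E[C^{k,n}(x^rand)]`: expectation over the random placement of the Cortés
model cost. -/
noncomputable def randCortes (n k : ℕ) : ℝ :=
  ∫ x in Set.univ.pi (fun _ : Fin n => Set.Icc (0:ℝ) 1), cortesCost k x

/-- The probability that all sensors of `S` fail is `p ^ |S|`. -/
lemma sum_prob_disjoint {n : ℕ} (p : ℝ) (S : Finset (Fin n)) :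
    ∑ A : Finset (Fin n), prob p A * (if Disjoint S A then 1 else 0) = p ^ S.card := by
  have h := Finset.prod_add (fun i : Fin n => if i ∈ S then (0 : ℝ) else 1 - p)
    (fun _ => p) Finset.univ
  have hl : ∏ i : Fin n, ((if i ∈ S then (0 : ℝ) else 1 - p) + p) = p ^ S.card := by
    have : ∀ i : Fin n, ((if i ∈ S then (0 : ℝ) else 1 - p) + p) = if i ∈ S then p else 1 := by
      intro i; split_ifs <;> ring
    simp only [this]
    rw [Finset.prod_ite_mem, Finset.univ_inter, Finset.prod_const]
  rw [hl, Finset.powerset_univ] at h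
  rw [h]
  refine Finset.sum_congr rfl fun A _ => ?_
  rw [Finset.prod_const, Finset.card_sdiff_of_subset (Finset.subset_univ A), Finset.card_univ,
    Fintype.card_fin, prob]
  by_cases hd : Disjoint S A
  · have : ∏ i ∈ A, (if i ∈ S then (0 : ℝ) else 1 - p) = (1 - p) ^ A.card := by
      rw [← Finset.prod_const]
      exact Finset.prod_congr rfl fun i hi => if_neg fun hS => Finset.disjoint_left.mp hd hS hi
    rw [this, if_pos hd]; ring
  · obtain ⟨i, hS, hA⟩ := Finset.not_disjoint_iff.mp hd
    rw [if_neg hd, Finset.prod_eq_zero hA (by simp [hS])]; ring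

lemma sum_prob {n : ℕ} (p : ℝ) : ∑ A : Finset (Fin n), prob p A = 1 := by
  simpa using sum_prob_disjoint p (∅ : Finset (Fin n))

lemma prob_nonneg {n : ℕ} {p : ℝ} (h0 : 0 ≤ p) (h1 : p ≤ 1) (A : Finset (Fin n)) :
    0 ≤ prob p A :=
  mul_nonneg (pow_nonneg h0 _) (pow_nonneg (sub_nonneg.mpr h1) _)

/-- The block of `k` consecutive indices starting at `i`. -/
def window (n i k : ℕ) : Finset (Fin n) :=
  Finset.univ.filter fun j => i ≤ j.1 ∧ j.1 < i + k

lemma card_window {n i k : ℕ} (h : i + k ≤ n) : (window n i k).card = k := by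
  have : (window n i k).map Fin.valEmbedding = Finset.Ico i (i + k) := by
    ext a
    simp only [window, Finset.mem_map, Finset.mem_filter, Finset.mem_univ, true_and,
      Fin.valEmbedding_apply, Finset.mem_Ico]
    exact ⟨fun ⟨j, hj, hja⟩ => hja ▸ hj, fun ha => ⟨⟨a, by omega⟩, ha, rfl⟩⟩
  rw [← Finset.card_map, this, Nat.card_Ico]; omega

lemma exists_mem_of_not_disjoint_window {n i k : ℕ} {A : Finset (Fin n)}
    (h : ¬ Disjoint (window n i k) A) : ∃ j ∈ A, i ≤ j.1 ∧ j.1 < i + k := by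
  obtain ⟨j, hj, hA⟩ := Finset.not_disjoint_iff.mp h
  exact ⟨j, hA, by simpa [window] using hj⟩

lemma iInf_dist_le {n : ℕ} (x : Fin n → ℝ) {A : Finset (Fin n)} (s : ℝ) {j : Fin n}
    (hj : j ∈ A) : ⨅ j : A, |s - x j.1| ≤ |s - x j| :=
  ciInf_le (f := fun j : A => |s - x j.1|) ⟨0, by rintro _ ⟨i, rfl⟩; exact abs_nonneg _⟩ ⟨j, hj⟩

lemma cost0_le {n : ℕ} {x : Fin n → ℝ} {A : Finset (Fin n)} {c : ℝ} (hA : A.Nonempty)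
    (h : ∀ s ∈ Set.Icc (0 : ℝ) 1, ∃ j ∈ A, |s - x j| ≤ c) : cost0 x A ≤ c := by
  rw [cost0, if_pos hA]
  have : Nonempty (Set.Icc (0 : ℝ) 1) := ⟨⟨0, by simp⟩⟩
  refine ciSup_le fun s => ?_
  obtain ⟨j, hj, hs⟩ := h s.1 s.2
  exact (iInf_dist_le x s.1 hj).trans hs

lemma le_cost0 {n : ℕ} {x : Fin n → ℝ} {A : Finset (Fin n)} (hA : A.Nonempty)
    {s : ℝ} (hs : s ∈ Set.Icc (0 : ℝ) 1) : ⨅ j : A, |s - x j.1| ≤ cost0 x A := by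
  rw [cost0, if_pos hA]
  obtain ⟨j, hj⟩ := hA
  refine le_ciSup (f := fun s : Set.Icc (0 : ℝ) 1 => ⨅ j : A, |s.1 - x j.1|)
    ⟨1 + |x j|, ?_⟩ ⟨s, hs⟩
  rintro _ ⟨t, rfl⟩
  refine (iInf_dist_le x t.1 hj).trans ((abs_sub _ _).trans ?_)
  have := abs_le.mpr ⟨by linarith [t.2.1], t.2.2⟩
  linarith

lemma exists_dist_le_cost0 {n : ℕ} {x : Fin n → ℝ} {A : Finset (Fin n)} (hA : A.Nonempty)
    {s : ℝ} (hs : s ∈ Set.Icc (0 : ℝ) 1) : ∃ j ∈ A, |s - x j| ≤ cost0 x A := by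
  have : Nonempty A := hA.to_subtype
  obtain ⟨j, hj⟩ := exists_eq_ciInf_of_finite (f := fun j : A => |s - x j.1|)
  exact ⟨j.1, j.2, hj.trans_le (le_cost0 hA hs)⟩

lemma cost0_nonneg {n : ℕ} (x : Fin n → ℝ) (A : Finset (Fin n)) : 0 ≤ cost0 x A := by
  by_cases hA : A.Nonempty
  · obtain ⟨j, -, hj⟩ := exists_dist_le_cost0 (x := x) hA (s := 0) (by simp)
    exact (abs_nonneg _).trans hj
  · simp [cost0, hA]

lemma cost0_le_one {n : ℕ} {x : Fin n → ℝ} (hx : ∀ i, x i ∈ Set.Icc (0 : ℝ) 1)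
    (A : Finset (Fin n)) : cost0 x A ≤ 1 := by
  by_cases hA : A.Nonempty
  · obtain ⟨j, hj⟩ := id hA
    refine cost0_le hA fun s hs => ⟨j, hj, abs_le.mpr ⟨?_, ?_⟩⟩ <;>
      linarith [hs.1, hs.2, (hx j).1, (hx j).2]
  · simp [cost0, hA]

/-- Stretching a placement about the center of `[0,1]` by a factor `r ≥ 1` multiplies the
coverage cost by at most `r`. -/
lemma cost0_stretch_le {n : ℕ} {x y : Fin n → ℝ} {r : ℝ} (hr : 1 ≤ r)
    (hy : ∀ i, y i = 1 / 2 + r * (x i - 1 / 2)) (A : Finset (Fin n)) :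
    cost0 y A ≤ r * cost0 x A := by
  by_cases hA : A.Nonempty
  · refine cost0_le hA fun s hs => ?_
    have hr0 : 0 < r := by linarith
    have ht : 1 / 2 + (s - 1 / 2) / r ∈ Set.Icc (0 : ℝ) 1 := by
      have h1 : (s - 1 / 2) / r ≤ 1 / 2 := by
        rw [div_le_iff₀ hr0]; linarith [hs.2]
      have h2 : -(1 / 2) ≤ (s - 1 / 2) / r := by
        rw [le_div_iff₀ hr0]; linarith [hs.1]
      constructor <;> linarith
    obtain ⟨j, hj, hle⟩ := exists_dist_le_cost0 (x := x) hA ht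
    refine ⟨j, hj, ?_⟩
    have : s - y j = r * (1 / 2 + (s - 1 / 2) / r - x j) := by
      rw [hy]; field_simp; ring
    rw [this, abs_mul, abs_of_pos hr0]
    exact mul_le_mul_of_nonneg_left hle hr0.le
  · simpa [cost0, hA] using hr

/-- The placement with sensors at both endpoints and equal gaps. -/
noncomputable def endpointPlacement (n : ℕ) : Fin n → ℝ := fun i => (i : ℝ) / (n - 1)

lemma endpointPlacement_mem {n : ℕ} (hn : 2 ≤ n) (i : Fin n) :
    endpointPlacement n i ∈ Set.Icc (0 : ℝ) 1 := by
  have hn' : (2 : ℝ) ≤ n := by exact_mod_cast hn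
  have hi : (i : ℝ) + 1 ≤ n := by exact_mod_cast i.2
  have hi0 : (0 : ℝ) ≤ i := Nat.cast_nonneg _
  refine ⟨div_nonneg hi0 (by linarith), ?_⟩
  rw [endpointPlacement, div_le_one (by linarith)]
  linarith

lemma xeq_mem {n : ℕ} (i : Fin n) : xeq n i ∈ Set.Icc (0 : ℝ) 1 := by
  have hi : (i : ℝ) + 1 ≤ n := by exact_mod_cast i.2
  have hi0 : (0 : ℝ) ≤ i := Nat.cast_nonneg _
  refine ⟨div_nonneg (by linarith) (by linarith), ?_⟩
  rw [xeq, div_le_one (by linarith)]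
  linarith

lemma endpointPlacement_eq_stretch {n : ℕ} (hn : 2 ≤ n) (i : Fin n) :
    endpointPlacement n i = 1 / 2 + (n / (n - 1) : ℝ) * (xeq n i - 1 / 2) := by
  have hn' : (2 : ℝ) ≤ n := by exact_mod_cast hn
  have h1 : (n : ℝ) - 1 ≠ 0 := by linarith
  have h2 : (n : ℝ) ≠ 0 := by linarith
  rw [endpointPlacement, xeq]
  field_simp
  ring

/-- Every `t ∈ [0, n]` is within a window of `k` unit steps that fits into `[0, n]`. -/
lemma exists_window_start {n k : ℕ} (hk : 1 ≤ k) (hkn : k ≤ n) {t : ℝ} (h0 : 0 ≤ t)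
    (h1 : t ≤ n) : ∃ i : ℕ, i + k ≤ n ∧ (i : ℝ) ≤ t ∧ t ≤ i + k := by
  by_cases h : ⌊t⌋₊ + k ≤ n
  · refine ⟨⌊t⌋₊, h, Nat.floor_le h0, ?_⟩
    have : (1 : ℝ) ≤ k := by exact_mod_cast hk
    linarith [Nat.lt_floor_add_one t]
  · refine ⟨n - k, by omega, ?_, ?_⟩
    · exact (Nat.le_floor_iff h0).mp (by omega)
    · rw [Nat.cast_sub hkn]; linarith

lemma cost0_xeq_le {n : ℕ} (hn : 3 ≤ n) {A : Finset (Fin n)}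
    (h : ∀ i, i + 3 ≤ n → ¬ Disjoint (window n i 3) A) : cost0 (xeq n) A ≤ 5 / (2 * n) := by
  have hn' : (3 : ℝ) ≤ n := by exact_mod_cast hn
  obtain ⟨j₀, hj₀, -⟩ := exists_mem_of_not_disjoint_window (h 0 (by omega))
  refine cost0_le ⟨j₀, hj₀⟩ fun s hs => ?_
  obtain ⟨i, hi, hi1, hi2⟩ := exists_window_start (k := 3) (by norm_num) hn
    (t := n * s) (by nlinarith [hs.1]) (by nlinarith [hs.2])
  obtain ⟨j, hj, hj1, hj2⟩ := exists_mem_of_not_disjoint_window (h i hi)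
  have hj1' : (i : ℝ) ≤ j := by exact_mod_cast hj1
  have hj2' : (j : ℝ) + 1 ≤ i + 3 := by exact_mod_cast hj2
  refine ⟨j, hj, ?_⟩
  have : s - xeq n j = (2 * (n * s) - (2 * j + 1)) / (2 * n) := by
    rw [xeq]; field_simp
  rw [this, abs_div, abs_of_pos (by linarith : (0 : ℝ) < 2 * n)]
  push_cast at hi2
  gcongr
  exact abs_le.mpr ⟨by linarith, by linarith⟩

lemma cost0_endpointPlacement_le {n : ℕ} (hn : 2 ≤ n) {A : Finset (Fin n)}
    (h : ∀ i, i + 2 ≤ n → ¬ Disjoint (window n i 2) A) :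
    cost0 (endpointPlacement n) A ≤ 1 / (n - 1) := by
  have hn' : (2 : ℝ) ≤ n := by exact_mod_cast hn
  obtain ⟨j₀, hj₀, -⟩ := exists_mem_of_not_disjoint_window (h 0 (by omega))
  refine cost0_le ⟨j₀, hj₀⟩ fun s hs => ?_
  obtain ⟨i, hi, hi1, hi2⟩ := exists_window_start (n := n - 1) (k := 1) le_rfl (by omega)
    (t := (n - 1) * s) (mul_nonneg (by linarith) hs.1)
    (by rw [Nat.cast_sub (by omega)]; push_cast; nlinarith [hs.2])
  obtain ⟨j, hj, hj1, hj2⟩ := exists_mem_of_not_disjoint_window (h i (by omega))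
  have hj1' : (i : ℝ) ≤ j := by exact_mod_cast hj1
  have hj2' : (j : ℝ) + 1 ≤ i + 2 := by exact_mod_cast hj2
  refine ⟨j, hj, ?_⟩
  have h1 : (0 : ℝ) < n - 1 := by linarith
  have : s - endpointPlacement n j = ((n - 1) * s - j) / (n - 1) := by
    rw [endpointPlacement]; field_simp
  rw [this, abs_div, abs_of_pos h1]
  push_cast at hi2
  gcongr
  exact abs_le.mpr ⟨by linarith, by linarith⟩

lemma le_cost0_xeq_of_disjoint {n : ℕ} (hn : 2 ≤ n) {A : Finset (Fin n)}
    (h : Disjoint (window n 0 1) A) : 3 / (2 * n) ≤ cost0 (xeq n) A := by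
  have hn' : (2 : ℝ) ≤ n := by exact_mod_cast hn
  by_cases hA : A.Nonempty
  · obtain ⟨j, hj, hle⟩ := exists_dist_le_cost0 (x := xeq n) hA (s := 0) (by simp)
    have hj1 : 1 ≤ j.1 := by
      by_contra hlt
      exact Finset.disjoint_left.mp h (by simp [window]; omega) hj
    have hj1' : (1 : ℝ) ≤ j := by exact_mod_cast hj1
    refine le_trans ?_ hle
    rw [zero_sub, abs_neg, abs_of_nonneg (xeq_mem j).1, xeq]
    gcongr
    linarith
  · rw [cost0, if_neg hA, div_le_one (by linarith)]
    linarith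

lemma expCost_xeq_le {n : ℕ} (hn : 3 ≤ n) {p : ℝ} (h0 : 0 ≤ p) (h1 : p ≤ 1) :
    expCost p (xeq n) ≤ 5 / (2 * n) + n * p ^ 3 := by
  have hpt : ∀ A : Finset (Fin n), cost0 (xeq n) A ≤
      5 / (2 * n) + ∑ i ∈ Finset.range (n - 2), if Disjoint (window n i 3) A then 1 else 0 := by
    intro A
    have hs : ∀ i ∈ Finset.range (n - 2),
        (0 : ℝ) ≤ if Disjoint (window n i 3) A then 1 else 0 := by
      intro i _; split_ifs <;> norm_num
    by_cases h : ∀ i, i + 3 ≤ n → ¬ Disjoint (window n i 3) A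
    · exact le_add_of_le_of_nonneg (cost0_xeq_le hn h) (Finset.sum_nonneg hs)
    · push Not at h
      obtain ⟨i, hi, hd⟩ := h
      have := Finset.single_le_sum hs (Finset.mem_range.mpr (by omega : i < n - 2))
      rw [if_pos hd] at this
      have h5 : (0 : ℝ) ≤ 5 / (2 * n) := by positivity
      linarith [cost0_le_one (xeq_mem (n := n)) A]
  calc expCost p (xeq n) ≤ ∑ A : Finset (Fin n), prob p A * (5 / (2 * n) +
        ∑ i ∈ Finset.range (n - 2), if Disjoint (window n i 3) A then 1 else 0) :=
        Finset.sum_le_sum fun A _ =>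
          mul_le_mul_of_nonneg_left (hpt A) (prob_nonneg h0 h1 A)
    _ = 5 / (2 * n) + ∑ i ∈ Finset.range (n - 2), p ^ (window n i 3).card := by
        simp only [mul_add, Finset.sum_add_distrib, ← Finset.sum_mul, sum_prob, one_mul,
          Finset.mul_sum]
        rw [Finset.sum_comm]
        simp only [sum_prob_disjoint]
    _ = 5 / (2 * n) + ((n - 2 : ℕ) : ℝ) * p ^ 3 := by
        rw [Finset.sum_congr rfl fun i hi => by
          rw [card_window (by have := Finset.mem_range.mp hi; omega)]]
        simp
    _ ≤ 5 / (2 * n) + n * p ^ 3 := by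
        gcongr
        omega

/-- The event that the first sensor fails and no two neighboring sensors fail. -/
def IsolatedFirstFailure {n : ℕ} (A : Finset (Fin n)) : Prop :=
  Disjoint (window n 0 1) A ∧ ∀ i, i + 2 ≤ n → ¬ Disjoint (window n i 2) A

open Classical in
lemma le_sum_prob_isolatedFirstFailure {n : ℕ} (hn : 2 ≤ n) {p : ℝ} (h0 : 0 ≤ p)
    (h1 : p ≤ 1) : p - p ^ 2 - n * p ^ 3 ≤
      ∑ A : Finset (Fin n), prob p A * (if IsolatedFirstFailure A then 1 else 0) := by
  have hpt : ∀ A : Finset (Fin n), (if Disjoint (window n 0 1) A then (1 : ℝ) else 0) ≤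
      (if IsolatedFirstFailure A then 1 else 0) + ∑ i ∈ Finset.range (n - 1),
        if Disjoint (window n 0 1 ∪ window n i 2) A then 1 else 0 := by
    intro A
    have hs : ∀ i ∈ Finset.range (n - 1),
        (0 : ℝ) ≤ if Disjoint (window n 0 1 ∪ window n i 2) A then 1 else 0 := by
      intro i _; split_ifs <;> norm_num
    have hs' := Finset.sum_nonneg hs
    by_cases hd : Disjoint (window n 0 1) A
    · by_cases h : ∀ i, i + 2 ≤ n → ¬ Disjoint (window n i 2) A
      · rw [if_pos hd, if_pos ⟨hd, h⟩]; linarith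
      · rw [if_pos hd, if_neg fun hI => h hI.2]
        push Not at h
        obtain ⟨i, hi, hdi⟩ := h
        have := Finset.single_le_sum hs (Finset.mem_range.mpr (by omega : i < n - 1))
        rw [if_pos (Finset.disjoint_union_left.mpr ⟨hd, hdi⟩)] at this
        linarith
    · rw [if_neg hd]
      split_ifs <;> linarith
  have hsum := Finset.sum_le_sum fun A (_ : A ∈ Finset.univ) =>
    mul_le_mul_of_nonneg_left (hpt A) (prob_nonneg h0 h1 A)
  simp only [mul_add, Finset.sum_add_distrib, Finset.mul_sum] at hsum
  rw [Finset.sum_comm (s := Finset.univ) (t := Finset.range (n - 1))] at hsum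
  simp only [sum_prob_disjoint] at hsum
  rw [card_window (by omega), pow_one] at hsum
  have hcard : ∀ i ∈ Finset.range (n - 1),
      p ^ (window n 0 1 ∪ window n i 2).card ≤ p ^ 3 + if i = 0 then p ^ 2 else 0 := by
    intro i hi
    have hi' := Finset.mem_range.mp hi
    have hw : (window n i 2).card = 2 := card_window (by omega)
    split_ifs with hi0
    · refine le_add_of_nonneg_of_le (pow_nonneg h0 3) (pow_le_pow_of_le_one h0 h1 ?_)
      exact hw.symm.le.trans (Finset.card_le_card Finset.subset_union_right)
    · rw [Finset.card_union_of_disjoint, card_window (by omega), hw]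
      · simp
      · refine Finset.disjoint_left.mpr fun j hj hj' => ?_
        simp only [window, Finset.mem_filter, Finset.mem_univ, true_and] at hj hj'
        omega
  have hb := Finset.sum_le_sum hcard
  rw [Finset.sum_add_distrib, Finset.sum_ite_eq', if_pos (Finset.mem_range.mpr (by omega))] at hb
  simp only [Finset.sum_const, Finset.card_range, nsmul_eq_mul] at hb
  have hn1 : ((n - 1 : ℕ) : ℝ) * p ^ 3 ≤ n * p ^ 3 := by
    gcongr
    omega
  linarith

lemma expCost_endpointPlacement_le {n : ℕ} (hn : 5 ≤ n) {p : ℝ} (h0 : 0 ≤ p) (h1 : p ≤ 1) :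
    expCost p (endpointPlacement n) ≤ n / (n - 1) * expCost p (xeq n)
      - (p - p ^ 2 - n * p ^ 3) * (3 / (2 * n) - 1 / (n - 1)) := by
  classical
  have hn' : (5 : ℝ) ≤ n := by exact_mod_cast hn
  have hpos : (0 : ℝ) < n - 1 := by linarith
  have hr : (1 : ℝ) ≤ n / (n - 1) := by rw [le_div_iff₀ hpos]; linarith
  have hgain : (0 : ℝ) ≤ 3 / (2 * n) - 1 / (n - 1) := by
    rw [sub_nonneg, div_le_div_iff₀ hpos (by linarith)]; linarith
  have hpt : ∀ A : Finset (Fin n), cost0 (endpointPlacement n) A ≤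
      n / (n - 1) * cost0 (xeq n) A -
        (if IsolatedFirstFailure A then 1 else 0) * (3 / (2 * n) - 1 / (n - 1)) := by
    intro A
    split_ifs with hI
    · have hx := le_cost0_xeq_of_disjoint (by omega) hI.1
      have hy := cost0_endpointPlacement_le (by omega) hI.2
      have := mul_le_mul_of_nonneg_right hr (cost0_nonneg (xeq n) A)
      linarith
    · rw [zero_mul, sub_zero]
      exact cost0_stretch_le hr (endpointPlacement_eq_stretch (by omega)) A
  have hsum := Finset.sum_le_sum fun A (_ : A ∈ Finset.univ) =>
    mul_le_mul_of_nonneg_left (hpt A) (prob_nonneg h0 h1 A)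
  have hprob := mul_le_mul_of_nonneg_right
    (le_sum_prob_isolatedFirstFailure (n := n) (by omega) h0 h1) hgain
  simp only [mul_sub (prob p _), Finset.sum_sub_distrib, ← mul_assoc (prob p _),
    ← Finset.sum_mul] at hsum
  have hx : ∑ A : Finset (Fin n), prob p A * (n / (n - 1) : ℝ) * cost0 (xeq n) A =
      n / (n - 1) * expCost p (xeq n) := by
    rw [expCost, Finset.mul_sum]
    exact Finset.sum_congr rfl fun A _ => by ring
  rw [hx] at hsum
  rw [expCost]
  linarith

/-- At failure probability `100 / n` the equispaced placement is not optimal. -/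
lemma expCost_endpointPlacement_lt {n : ℕ} (hn : 10 ^ 7 ≤ n) :
    expCost (100 / n) (endpointPlacement n) < expCost (100 / n) (xeq n) := by
  have hn' : (10 ^ 7 : ℝ) ≤ n := by exact_mod_cast hn
  have hn0 : (0 : ℝ) < n := by linarith
  have hpos : (0 : ℝ) < n - 1 := by linarith
  have h0 : (0 : ℝ) ≤ 100 / n := by positivity
  have h1 : (100 / n : ℝ) ≤ 1 := by rw [div_le_one hn0]; linarith
  have hy := expCost_endpointPlacement_le (n := n) (by omega) h0 h1
  have hx := expCost_xeq_le (n := n) (by omega) h0 h1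
  have hx' : expCost (100 / n) (xeq n) ≤ 3 / n := by
    refine hx.trans ?_
    have : (5 / (2 * n) + n * (100 / n) ^ 3 : ℝ) = (5 / 2 + 10 ^ 6 / n) / n := by
      field_simp; ring
    rw [this]
    gcongr
    have : (10 ^ 6 / n : ℝ) ≤ 1 / 2 := by rw [div_le_iff₀ hn0]; linarith
    linarith
  have hprob : (50 / n : ℝ) ≤ 100 / n - (100 / n) ^ 2 - n * (100 / n) ^ 3 := by
    have : (100 / n - (100 / n) ^ 2 - n * (100 / n) ^ 3 : ℝ) =
        (100 - (10 ^ 4 + 10 ^ 6) / n) / n := by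
      field_simp; ring
    rw [this]
    gcongr
    have : ((10 ^ 4 + 10 ^ 6) / n : ℝ) ≤ 50 := by rw [div_le_iff₀ hn0]; linarith
    linarith
  have hgain : (1 / (4 * (n - 1)) : ℝ) ≤ 3 / (2 * n) - 1 / (n - 1) := by
    have : (1 / (4 * (n - 1)) + 1 / (n - 1) : ℝ) ≤ 3 / (2 * n) := by
      have : (1 / (4 * (n - 1)) + 1 / (n - 1) : ℝ) = 5 / (4 * (n - 1)) := by
        field_simp; norm_num
      rw [this, div_le_div_iff₀ (by linarith) (by linarith)]
      linarith
    linarith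
  have hmul : (50 / n : ℝ) * (1 / (4 * (n - 1))) ≤
      (100 / n - (100 / n) ^ 2 - n * (100 / n) ^ 3) * (3 / (2 * n) - 1 / (n - 1)) :=
    mul_le_mul hprob hgain (by positivity) (le_trans (by positivity) hprob)
  have hsplit : (n / (n - 1) : ℝ) * expCost (100 / n) (xeq n) =
      expCost (100 / n) (xeq n) + expCost (100 / n) (xeq n) / (n - 1) := by
    field_simp; ring
  have hloss : expCost (100 / n) (xeq n) / (n - 1) ≤ 3 / n / (n - 1) := by gcongr
  have hlt : (3 / n / (n - 1) : ℝ) < 50 / n * (1 / (4 * (n - 1))) := by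
    have : (50 / n * (1 / (4 * (n - 1))) : ℝ) = (25 / 2) / n / (n - 1) := by
      field_simp; norm_num
    rw [this]
    gcongr
    norm_num
  linarith

/-- there is a constant `c₀ > 0` such that, for every `n ≥ 1`,
if the equispaced placement is optimal for every failure probability
`p ∈ (0, q)` (with `q ∈ (0,1)`), then `q ≤ c₀/n`. -/
theorem xeq_optimal_neighborhood_small :
    ∃ c0 : ℝ, 0 < c0 ∧ ∀ n : ℕ, 1 ≤ n → ∀ q : ℝ, 0 < q → q < 1 →
      (∀ p : ℝ, 0 < p → p < q →
        ∀ x : Fin n → ℝ, (∀ i, x i ∈ Set.Icc (0:ℝ) 1) →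
          expCost p (xeq n) ≤ expCost p x) →
      q ≤ c0 / n := by
  refine ⟨10 ^ 7, by norm_num, fun n hn q _ hq1 hopt => ?_⟩
  by_contra! hlt
  have hn0 : (0 : ℝ) < n := by exact_mod_cast hn
  have hbig : 10 ^ 7 ≤ n := by
    have : (10 ^ 7 / n : ℝ) < 1 := hlt.trans hq1
    rw [div_lt_one hn0] at this
    exact_mod_cast this.le
  have hp : (100 / n : ℝ) < q := lt_of_le_of_lt (by gcongr; norm_num) hlt
  exact (expCost_endpointPlacement_lt hbig).not_ge
    (hopt _ (by positivity) hp _ (endpointPlacement_mem (by omega)))
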